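/- arXiv:1011.2887 — 2 statements merged into one kernel-verified Lean document; each statement's English description precedes it below -/
import Mathlib

section
/- Let D ∈ ℕ, and let p_1, ..., p_m be distinct primes with p_i ≥ D + 3 for all i. Set b^i = e^{2πi/p_i} and let b̃^i = Σ_{j=1}^i a^i_j (b^j + conj(b^j)) with a^i_j ∈ ℚ and a^i_i ≠ 0. Then for every nonzero polynomial g ∈ ℚ[Y_1,...,Y_m] of total degree at most ⌊(D+1)/2⌋, g(Re(b̃^1), ..., Re(b̃^m)) ≠ 0. -/
/-- Substituting polynomials of total degree at most one does not raise the total degree. -/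
theorem MvPolynomial.totalDegree_aeval_le_of_totalDegree_le_one {σ τ R : Type*} [CommSemiring R]
    (f : σ → MvPolynomial τ R) (hf : ∀ i, (f i).totalDegree ≤ 1) (g : MvPolynomial σ R) :
    (aeval f g).totalDegree ≤ g.totalDegree := by
  rw [aeval_def, eval₂_eq]
  refine totalDegree_finsetSum_le fun d hd => ?_
  refine (totalDegree_mul _ _).trans ?_
  have hC : (algebraMap R (MvPolynomial τ R) (coeff d g)).totalDegree = 0 := totalDegree_C _
  rw [hC, zero_add]
  refine (totalDegree_finsetProd _ _).trans ((Finset.sum_le_sum fun i _ => ?_).trans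
    (le_totalDegree hd))
  exact (totalDegree_pow _ _).trans ((Nat.mul_le_mul_left _ (hf i)).trans_eq (mul_one _))

/-- A polynomial relation over `ℚ` between the numbers `ζ ^ e i + ζ ^ (-e i)`, for a root of
unity `ζ`, persists when `ζ` is replaced by a conjugate. -/
theorem IsPrimitiveRoot.aeval_pow_add_inv_eq_zero {ι K : Type*} [Field K] [CharZero K]
    {N : ℕ} (hN : 0 < N) {ζ : K} (hζ : IsPrimitiveRoot ζ N) (e : ι → ℕ)
    (h : MvPolynomial ι ℚ)
    (h0 : MvPolynomial.aeval (fun i => ζ ^ e i + (ζ ^ e i)⁻¹) h = 0)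
    {k : ℕ} (hk : k.Coprime N) :
    MvPolynomial.aeval (fun i => (ζ ^ e i) ^ k + ((ζ ^ e i) ^ k)⁻¹) h = 0 := by
  set F : Polynomial ℚ :=
    MvPolynomial.aeval (fun i => Polynomial.X ^ e i + Polynomial.X ^ (e i * (N - 1))) h with hF
  have key (μ : K) (hμ : IsPrimitiveRoot μ N) :
      Polynomial.aeval μ F = MvPolynomial.aeval (fun i => μ ^ e i + (μ ^ e i)⁻¹) h := by
    rw [hF, ← AlgHom.comp_apply, MvPolynomial.comp_aeval]
    congr 2
    funext i
    have hinv : μ ^ (N - 1) = μ⁻¹ := by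
      refine eq_inv_of_mul_eq_one_left ?_
      rw [← pow_succ, Nat.sub_add_cancel hN, hμ.pow_eq_one]
    simp only [map_add, map_pow, Polynomial.aeval_X]
    rw [mul_comm (e i), pow_mul, hinv, inv_pow]
  have hk' := hζ.pow_of_coprime k hk
  have hdvd : minpoly ℚ (ζ ^ k) ∣ F := by
    rw [← Polynomial.cyclotomic_eq_minpoly_rat hk' hN, Polynomial.cyclotomic_eq_minpoly_rat hζ hN]
    exact minpoly.dvd _ _ (by rw [key ζ hζ, h0])
  have := key _ hk'
  rw [(minpoly.dvd_iff).1 hdvd] at this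
  simp only [← pow_mul, mul_comm k] at this ⊢
  exact this.symm

/-- A polynomial relation over `ℚ` between the numbers `ω i + (ω i)⁻¹`, for roots of unity `ω i`
of pairwise coprime orders, persists when the `ω i` are independently replaced by conjugates. -/
theorem MvPolynomial.aeval_primitiveRoot_pow_add_inv_eq_zero {ι : Type*} [Fintype ι] {p : ι → ℕ}
    (hp : ∀ i, p i ≠ 0) (hcop : Pairwise (Function.onFun Nat.Coprime p))
    {ω : ι → ℂ} (hω : ∀ i, IsPrimitiveRoot (ω i) (p i)) (h : MvPolynomial ι ℚ)
    (h0 : aeval (fun i => ω i + (ω i)⁻¹) h = 0) (k : ι → ℕ) (hk : ∀ i, (k i).Coprime (p i)) :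
    aeval (fun i => ω i ^ k i + (ω i ^ k i)⁻¹) h = 0 := by
  have hN : ∏ i, p i ≠ 0 := Finset.prod_ne_zero_iff.2 fun i _ => hp i
  have hζ := Complex.isPrimitiveRoot_exp (∏ i, p i) hN
  set ζ := Complex.exp (2 * Real.pi * Complex.I / ((∏ i, p i : ℕ) : ℂ))
  have : NeZero (∏ i, p i) := ⟨hN⟩
  have hexp (i : ι) : ∃ e, ζ ^ e = ω i := by
    obtain ⟨e, -, he⟩ := hζ.eq_pow_of_pow_eq_one (ξ := ω i)
      (((hω i).pow_eq_one_iff_dvd _).2 (Finset.dvd_prod_of_mem p (Finset.mem_univ i)))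
    exact ⟨e, he⟩
  choose e he using hexp
  obtain ⟨n, hn⟩ := Nat.chineseRemainderOfFinset k p Finset.univ (fun i _ => hp i)
    (fun i _ j _ hij => hcop hij)
  have hn (i : ι) : n ≡ k i [MOD p i] := hn i (Finset.mem_univ i)
  have hnN : n.Coprime (∏ i, p i) := Nat.Coprime.prod_right fun i _ => by
    rw [Nat.Coprime, (hn i).gcd_eq]
    exact hk i
  have := hζ.aeval_pow_add_inv_eq_zero (Nat.pos_of_ne_zero hN) e h (by simpa only [he] using h0) hnN
  simp only [he] at this
  have hpow (i : ι) : ω i ^ n = ω i ^ k i :=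
    pow_eq_pow_of_modEq (hn i) (hω i).pow_eq_one
  simpa only [hpow] using this

theorem Complex.exp_two_pi_mul_I_div_pow_add_inv (n k : ℕ) :
    exp (2 * Real.pi * I / n) ^ k + (exp (2 * Real.pi * I / n) ^ k)⁻¹
      = ((2 * Real.cos (2 * Real.pi * k / n) : ℝ) : ℂ) := by
  rw [← exp_nat_mul, ← exp_neg]
  push_cast
  rw [two_cos]
  congr 2 <;> ring

/-- For distinct primes `p i`, the numbers `2 cos (2π / p i)` satisfy no nontrivial polynomial
relation over `ℚ` of degree less than `(p i - 1) / 2` in the `i`-th variable for every `i`. -/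
theorem MvPolynomial.eq_zero_of_aeval_two_cos_eq_zero {ι : Type*} [Fintype ι] {p : ι → ℕ}
    (hp : ∀ i, (p i).Prime) (hinj : Function.Injective p) (h : MvPolynomial ι ℚ)
    (hdeg : ∀ i, h.degreeOf i < (p i - 1) / 2)
    (h0 : aeval (fun i => 2 * Real.cos (2 * Real.pi / p i)) h = 0) : h = 0 := by
  classical
  have hcast (x : ι → ℝ) : aeval (fun i => (x i : ℂ)) h = ((aeval x h : ℝ) : ℂ) :=
    (aeval_algebraMap_apply ℂ x h)
  have hconj (k : ι → ℕ) (hk : ∀ i, (k i).Coprime (p i)) :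
      aeval (fun i => 2 * Real.cos (2 * Real.pi * k i / p i)) h = 0 := by
    have := aeval_primitiveRoot_pow_add_inv_eq_zero (fun i => (hp i).ne_zero)
      (fun i j hij => (Nat.coprime_primes (hp i) (hp j)).2 (hinj.ne hij))
      (fun i => Complex.isPrimitiveRoot_exp (p i) (hp i).ne_zero) h ?_ k hk
    · simp only [Complex.exp_two_pi_mul_I_div_pow_add_inv, hcast] at this
      exact_mod_cast this
    · have h1 (i : ι) := Complex.exp_two_pi_mul_I_div_pow_add_inv (p i) 1
      simp only [pow_one, Nat.cast_one, mul_one] at h1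
      simp only [h1, hcast, h0, Complex.ofReal_zero]
  refine map_injective (algebraMap ℚ ℝ) (algebraMap ℚ ℝ).injective ?_
  rw [map_zero]
  refine eq_zero_of_eval_zero_at_prod_finset _ (fun i => (Finset.Icc 1 ((p i - 1) / 2)).image
    fun k : ℕ => 2 * Real.cos (2 * Real.pi * k / p i)) (fun i => ?_) fun x hx => ?_
  · have hpos : (0 : ℝ) < p i := by exact_mod_cast (hp i).pos
    rw [Finset.card_image_of_injOn, Nat.card_Icc, Nat.add_sub_cancel]
    · refine lt_of_le_of_lt ?_ (hdeg i)
      exact degreeOf_le_iff.2 fun d hd => degreeOf_le_iff.1 le_rfl d (support_map_subset _ _ hd)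
    · have hmem {k : ℕ} (hk : k ∈ Finset.Icc 1 ((p i - 1) / 2)) :
          2 * Real.pi * k / p i ∈ Set.Icc 0 Real.pi := by
        have h2 : 2 * k ≤ p i := by
          have := (Finset.mem_Icc.1 hk).2
          omega
        have h2' : (2 : ℝ) * k ≤ p i := by exact_mod_cast h2
        refine ⟨by positivity, ?_⟩
        rw [div_le_iff₀ hpos]
        nlinarith [Real.pi_pos]
      intro k hk l hl hkl
      have := Real.injOn_cos (hmem hk) (hmem hl) (mul_left_cancel₀ two_ne_zero hkl)
      rw [div_left_inj' hpos.ne'] at this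
      exact_mod_cast mul_left_cancel₀ Real.two_pi_pos.ne' this
  · have hx' (i : ι) : ∃ k ∈ Finset.Icc 1 ((p i - 1) / 2),
        2 * Real.cos (2 * Real.pi * (k : ℕ) / p i) = x i := Finset.mem_image.1 (hx i)
    choose k hk hkx using hx'
    rw [eval_map, ← aeval_def, ← _root_.funext hkx]
    refine hconj k fun i => ?_
    have := Finset.mem_Icc.1 (hk i)
    exact (Nat.coprime_of_lt_prime (by omega) (by have := (hp i).pos; omega) (hp i)).symm

/-- Real version: let `p_1, …, p_m` be distinct primes with `p_i ≥ D + 3`,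
`b^i = e^{2πi/p_i}`, and `b̃^i = ∑_{j ≤ i} a^i_j (b^j + conj b^j)` with rational
coefficients and `a^i_i ≠ 0`.  Then no nonzero rational polynomial of total degree at
most `⌊(D+1)/2⌋` vanishes at `(Re b̃^1, …, Re b̃^m)`. -/
theorem stmt11 (D m : ℕ) (p : Fin m → ℕ) (hp : ∀ i, (p i).Prime)
    (hdist : Function.Injective p) (hge : ∀ i, D + 3 ≤ p i)
    (a : Fin m → Fin m → ℚ) (ha : ∀ i, a i i ≠ 0)
    (tb : Fin m → ℂ)
    (htb : ∀ i, tb i = ∑ j ∈ Finset.Iic i,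
      (a i j : ℂ) * (Complex.exp (2 * Real.pi * Complex.I / (p j : ℂ))
        + (starRingEnd ℂ) (Complex.exp (2 * Real.pi * Complex.I / (p j : ℂ)))))
    (g : MvPolynomial (Fin m) ℚ) (hg : g ≠ 0) (hdeg : g.totalDegree ≤ (D + 1) / 2) :
    MvPolynomial.aeval (fun i => (tb i).re) g ≠ 0 := by
  intro h0
  set L : Fin m → MvPolynomial (Fin m) ℚ := fun i =>
    ∑ j ∈ Finset.Iic i, MvPolynomial.C (a i j) * MvPolynomial.X j with hL
  have hLdeg (i : Fin m) : (L i).totalDegree ≤ 1 :=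
    MvPolynomial.totalDegree_finsetSum_le fun j _ => (MvPolynomial.totalDegree_mul _ _).trans
      (by rw [MvPolynomial.totalDegree_C, MvPolynomial.totalDegree_X])
  have hsubst : MvPolynomial.aeval L g = 0 := by
    refine MvPolynomial.eq_zero_of_aeval_two_cos_eq_zero hp hdist _ (fun i => ?_) ?_
    · have hdeg' := ((MvPolynomial.degreeOf_le_totalDegree _ i).trans
        (MvPolynomial.totalDegree_aeval_le_of_totalDegree_le_one L hLdeg g)).trans hdeg
      have := hge i
      obtain h2 | h2 := (hp i).eq_two_or_odd <;> omega
    · rw [← AlgHom.comp_apply, MvPolynomial.comp_aeval, ← h0]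
      congr 2
      funext i
      have h1 (j : Fin m) := Complex.exp_two_pi_mul_I_div_pow_add_inv (p j) 1
      simp only [pow_one, Nat.cast_one, mul_one] at h1
      have hreal : tb i = ((∑ j ∈ Finset.Iic i,
          (a i j : ℝ) * (2 * Real.cos (2 * Real.pi / p j)) : ℝ) : ℂ) := by
        rw [htb, Complex.ofReal_sum]
        refine Finset.sum_congr rfl fun j _ => ?_
        rw [← Complex.inv_eq_conj
          ((Complex.isPrimitiveRoot_exp (p j) (hp j).ne_zero).norm'_eq_one (hp j).ne_zero), h1]
        push_cast
        rfl
      rw [hreal, Complex.ofReal_re]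
      simp [hL]
  let A : Matrix (Fin m) (Fin m) ℚ := Matrix.of fun i j => if j ≤ i then a i j else 0
  have hA : IsUnit A := by
    rw [Matrix.isUnit_iff_isUnit_det, Matrix.det_of_isLowerTriangular A ?_, isUnit_iff_ne_zero,
      Finset.prod_ne_zero_iff]
    · simpa [A] using ha
    · exact fun i j hij => if_neg (not_le.2 hij)
  refine hg (MvPolynomial.funext fun y => ?_)
  obtain ⟨x, rfl⟩ := Matrix.mulVec_surjective_iff_isUnit.2 hA y
  have hx := congrArg (MvPolynomial.aeval x) hsubst
  rw [← AlgHom.comp_apply, MvPolynomial.comp_aeval, map_zero] at hx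
  rw [map_zero, ← hx, ← MvPolynomial.aeval_eq_eval]
  congr 2
  funext i
  simp [hL, A, Matrix.mulVec, dotProduct, ite_mul, ← Finset.sum_filter, Finset.filter_ge_eq_Iic]
end

section
/- Let 1 ≤ s < m. If K ≥ (m·C(s+r,s) + 1)/(m - s), then there exists a K-tuple of points in F^m that is (s,r)-elusive, i.e., not contained in the image of any polynomial mapping F^s → F^m of degree at most r. -/
/-- There are at most `C(|σ|+r, |σ|)` monomials of total degree at most `r` in the variables
`σ`. -/
theorem Finsupp.finite_and_natCard_degree_le (σ : Type*) [Fintype σ] (r : ℕ) :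
    Finite {d : σ →₀ ℕ // d.degree ≤ r} ∧
      Nat.card {d : σ →₀ ℕ // d.degree ≤ r} ≤
        (Fintype.card σ + r).choose (Fintype.card σ) := by
  classical
  let f : {d : σ →₀ ℕ // d.degree ≤ r} → Sym (Option σ) r := fun d =>
    ⟨(Finsupp.toMultiset d.1).map Option.some + Multiset.replicate (r - d.1.degree) none, by
      have h : (Finsupp.toMultiset d.1).card = d.1.degree := by
        rw [Finsupp.card_toMultiset, Finsupp.degree_apply, Finsupp.sum]; rfl
      simp only [Multiset.card_add, Multiset.card_map, Multiset.card_replicate, h]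
      exact Nat.add_sub_cancel' d.2⟩
  have hf : Function.Injective f := by
    intro d e hde
    ext i
    have h := congrArg (fun t : Sym (Option σ) r => Multiset.count (Option.some i) t.1) hde
    simpa [f, Multiset.count_map_eq_count' _ _ (Option.some_injective σ),
      Multiset.count_replicate] using h
  refine ⟨Finite.of_injective f hf, (Nat.card_le_card_of_injective f hf).trans_eq ?_⟩
  rw [Nat.card_eq_fintype_card, Sym.card_sym_eq_choose, Fintype.card_option,
    Nat.add_right_comm, Nat.add_sub_cancel, ← Nat.choose_symm (Nat.le_add_left r _),
    Nat.add_sub_cancel]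

/-- A polynomial map between finite-dimensional affine spaces over an infinite field which
raises the dimension is not surjective. -/
theorem MvPolynomial.exists_forall_eval_ne {F ι κ : Type*} [Field F] [Infinite F] [Finite ι]
    [Finite κ] (h : Nat.card ι < Nat.card κ) (G : κ → MvPolynomial ι F) :
    ∃ b : κ → F, ∀ y : ι → F, (fun k => eval y (G k)) ≠ b := by
  have hG : ¬ AlgebraicIndependent F G := by
    intro hG
    have h₁ := hG.lift_cardinalMk_le_trdeg
    rw [MvPolynomial.trdeg_of_isDomain] at h₁
    have h₂ := Cardinal.toNat_le_toNat h₁ (by simp [Cardinal.mk_lt_aleph0])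
    simp only [Cardinal.toNat_lift] at h₂
    exact h.not_ge h₂
  obtain ⟨P, hP, hP₀⟩ : ∃ P : MvPolynomial κ F, aeval G P = 0 ∧ P ≠ 0 := by
    rw [algebraicIndependent_iff] at hG
    push Not at hG
    exact hG
  by_contra! hsurj
  refine hP₀ (MvPolynomial.funext fun b => ?_)
  obtain ⟨y, rfl⟩ := hsurj b
  have h := congrArg (eval y) hP
  rw [map_zero, aeval_def, ← coe_eval₂Hom, ← RingHom.comp_apply] at h
  rw [map_zero, ← h]
  congr 1
  ext <;> simp

/-- Evaluation of a polynomial of total degree at most `r` as a sum over the monomials of degree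
at most `r`. -/
theorem MvPolynomial.eval_eq_sum_degree_le {F σ : Type*} [CommSemiring F] [Fintype σ] {r : ℕ}
    [Fintype {d : σ →₀ ℕ // d.degree ≤ r}] (p : MvPolynomial σ F) (hp : p.totalDegree ≤ r)
    (x : σ → F) :
    eval x p = ∑ d : {d : σ →₀ ℕ // d.degree ≤ r}, p.coeff d * ∏ i, x i ^ d.1 i := by
  classical
  rw [eval_eq']
  let T : Finset (σ →₀ ℕ) :=
    (Finset.univ : Finset {d : σ →₀ ℕ // d.degree ≤ r}).map (Function.Embedding.subtype _)
  have hT : p.support ⊆ T := by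
    intro d hd
    have : d.degree ≤ r := by
      refine le_trans ?_ hp
      have := le_totalDegree hd
      rwa [Finsupp.sum, ← Finsupp.degree_apply] at this
    simp [T, this]
  rw [Finset.sum_subset hT]
  · simp [T]
  · intro d _ hd
    rw [notMem_support_iff.mp hd, zero_mul]

/-- If `1 ≤ s < m` and `K ≥ (m·C(s+r,s) + 1)/(m - s)`, then there exists a `K`-tuple of
points of `F^m` which is `(s,r)`-elusive, i.e. not contained in the image of any
polynomial mapping `F^s → F^m` of degree at most `r`. -/
theorem stmt13 (F : Type*) [Field F] [IsAlgClosed F] [CharZero F] (s r m K : ℕ)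
    (hs : 1 ≤ s) (hsm : s < m)
    (hK : ((m * (s + r).choose s + 1 : ℚ)) / ((m : ℚ) - (s : ℚ)) ≤ (K : ℚ)) :
    ∃ b : Fin K → Fin m → F,
      ∀ Γ : Fin m → MvPolynomial (Fin s) F, (∀ l, (Γ l).totalDegree ≤ r) →
        ¬ (Set.range b ⊆ Set.range fun x : Fin s → F => fun l => MvPolynomial.eval x (Γ l)) := by
  classical
  obtain ⟨hfin, hcard⟩ := Finsupp.finite_and_natCard_degree_le (Fin s) r
  have := Fintype.ofFinite {d : Fin s →₀ ℕ // d.degree ≤ r}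
  rw [Fintype.card_fin] at hcard
  have hdim : m * (s + r).choose s + K * s < K * m := by
    have hms : (0 : ℚ) < (m : ℚ) - s := sub_pos.mpr (by exact_mod_cast hsm)
    rw [div_le_iff₀ hms] at hK
    have : ((m * (s + r).choose s + K * s : ℕ) : ℚ) < ((K * m : ℕ) : ℚ) := by
      push_cast
      linarith
    exact_mod_cast this
  let G : Fin K × Fin m →
      MvPolynomial ((Fin m × {d : Fin s →₀ ℕ // d.degree ≤ r}) ⊕ (Fin K × Fin s)) F := fun q =>
    ∑ d, MvPolynomial.X (Sum.inl (q.2, d)) *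
      ∏ i, MvPolynomial.X (Sum.inr (q.1, i)) ^ d.1 i
  obtain ⟨b, hb⟩ := MvPolynomial.exists_forall_eval_ne (G := G) (by
    simp only [Nat.card_sum, Nat.card_prod, Nat.card_fin]
    have := Nat.mul_le_mul_left m hcard
    lia)
  refine ⟨fun k l => b (k, l), fun Γ hΓ hsub => ?_⟩
  choose x hx using fun k => hsub (Set.mem_range_self k)
  refine hb (Sum.elim (fun q => (Γ q.1).coeff q.2) fun q => x q.1 q.2) (funext fun q => ?_)
  have h : MvPolynomial.eval (x q.1) (Γ q.2) = b q := congrFun (hx q.1) q.2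
  rw [← h, MvPolynomial.eval_eq_sum_degree_le _ (hΓ q.2)]
  simp [G]
end
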